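/- Let d ≥ 1 be an integer and let u : ℝ^{d+1} → ℝ be a Lipschitz global solution of the thin obstacle problem with zero obstacle, in the following sense: u is even in the variable y (u(x,y) = u(x,−y)), harmonic in {y ≠ 0}, u(x,0) ≥ 0 for all x ∈ ℝ^d, and for every x ∈ ℝ^d the one-sided derivative ∂_y u(x,0⁺) := lim_{t→0⁺}(u(x,t) − u(x,0))/t exists, satisfies ∂_y u(x,0⁺) ≤ 0, and equals 0 whenever u(x,0) > 0. If u(0,0) = 0, then u(x,0) = 0 for every x ∈ ℝ^d. -/

import Mathlib

open MeasureTheory Set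

/-- Euclidean space `ℝ^d`. -/
abbrev Esp (d : ℕ) := EuclideanSpace ℝ (Fin d)

/-- The upper half-ball `B_r⁺ = B_r ∩ {y > 0}` in `ℝ^{d+1} = ℝ^d × ℝ`. -/
def upBall (d : ℕ) (r : ℝ) : Set (Esp d × ℝ) := {p | ‖p.1‖^2 + p.2^2 < r^2 ∧ 0 < p.2}

/-- The thin ball `B_r' = B_r ∩ {y = 0}` in `ℝ^{d+1} = ℝ^d × ℝ`. -/
def flatBall (d : ℕ) (r : ℝ) : Set (Esp d × ℝ) := {p | ‖p.1‖^2 + p.2^2 < r^2 ∧ p.2 = 0}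

/-- Laplacian on `ℝ^d × ℝ`, computed through iterated coordinate derivatives. -/
noncomputable def lapH (d : ℕ) (u : Esp d × ℝ → ℝ) (p : Esp d × ℝ) : ℝ :=
  (∑ i : Fin d,
    deriv (deriv (fun t : ℝ => u (p.1 + t • EuclideanSpace.single i (1:ℝ), p.2))) 0)
  + deriv (deriv (fun t : ℝ => u (p.1, p.2 + t))) 0

/-- `u` is harmonic on the open set `U`: it is `C²` there and its Laplacian vanishes. -/
def HarmonicOnH (d : ℕ) (u : Esp d × ℝ → ℝ) (U : Set (Esp d × ℝ)) : Prop :=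
  ContDiffOn ℝ 2 u U ∧ ∀ p ∈ U, lapH d u p = 0

/-- Vertical partial derivative `∂_y u`. -/
noncomputable def pdy (d : ℕ) (u : Esp d × ℝ → ℝ) (p : Esp d × ℝ) : ℝ :=
  deriv (fun t : ℝ => u (p.1, p.2 + t)) 0

/-- Squared norm of the tangential gradient `|∇_x u|²`. -/
noncomputable def tangGradSq (d : ℕ) (u : Esp d × ℝ → ℝ) (p : Esp d × ℝ) : ℝ :=
  ∑ i : Fin d,
    (deriv (fun t : ℝ => u (p.1 + t • EuclideanSpace.single i (1:ℝ), p.2)) 0)^2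

/-- Squared norm of the full gradient `|∇u|²`. -/
noncomputable def gradSqH (d : ℕ) (u : Esp d × ℝ → ℝ) (p : Esp d × ℝ) : ℝ :=
  tangGradSq d u p + (pdy d u p)^2

/-- `L` is the one-sided vertical derivative `∂_y u(x,0⁺)`. -/
def NormalDeriv (d : ℕ) (u : Esp d × ℝ → ℝ) (x : Esp d) (L : ℝ) : Prop :=
  Filter.Tendsto (fun t => (u (x, t) - u (x, 0)) / t) (nhdsWithin 0 (Set.Ioi 0)) (nhds L)

/-- `f : [0,∞) → (0,∞)` is `L`-Lipschitz with `f ≤ f 0 = θ`. -/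
def GoodF (θ L : ℝ) (f : ℝ → ℝ) : Prop :=
  f 0 = θ ∧ (∀ s : ℝ, 0 ≤ s → 0 < f s ∧ f s ≤ θ) ∧
  (∀ s t : ℝ, 0 ≤ s → 0 ≤ t → |f s - f t| ≤ L * |s - t|)

/-- `u` is a solution of the two-phase thin obstacle problem in `B₁` with nonlinearity `f`
and obstacle `φ`: continuous on `B₁⁺ ∪ B₁'`, harmonic in `B₁⁺`, and on `B₁'` the one-sided
vertical derivative exists, is bounded by `θ` in absolute value, and equals
`f(|u−φ|)·sign(u−φ)` off the contact set. -/
def TwoPhaseSolH (d : ℕ) (θ : ℝ) (f : ℝ → ℝ) (φ : Esp d → ℝ) (u : Esp d × ℝ → ℝ) : Prop :=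
  ContinuousOn u (upBall d 1 ∪ flatBall d 1) ∧
  HarmonicOnH d u (upBall d 1) ∧
  ∀ x : Esp d, ‖x‖ < 1 → ∃ L : ℝ, NormalDeriv d u x L ∧ |L| ≤ θ ∧
    (u (x, 0) ≠ φ x → L = f |u (x, 0) - φ x| * Real.sign (u (x, 0) - φ x))

/-- `φ` is of class `C^{1,1}` on `B₁'` with `C^{1,1}` norm at most `P`. -/
def C11Bound (d : ℕ) (P : ℝ) (φ : Esp d → ℝ) : Prop :=
  (∀ x : Esp d, ‖x‖ < 1 → DifferentiableAt ℝ φ x ∧ |φ x| ≤ P ∧ ‖fderiv ℝ φ x‖ ≤ P) ∧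
  (∀ x y : Esp d, ‖x‖ < 1 → ‖y‖ < 1 → ‖fderiv ℝ φ x - fderiv ℝ φ y‖ ≤ P * ‖x - y‖)

section ThinObstacle

open Filter Topology InnerProductSpace Laplacian

open scoped RealInnerProductSpace

/-- The necessary second order condition at a local maximum in one variable. -/
theorem deriv_deriv_nonpos_of_isLocalMax {g : ℝ → ℝ} {x : ℝ} (hg : ContDiffAt ℝ 2 g x)
    (hmax : IsLocalMax g x) : deriv (deriv g) x ≤ 0 := by
  by_contra! hpos
  set c := deriv (deriv g) x with hc
  have hd : ∀ᶠ t in 𝓝 x, DifferentiableAt ℝ g t :=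
    (hg.eventually (by simp)).mono fun t ht => ht.differentiableAt (by simp)
  have hq (t : ℝ) : HasDerivAt (fun s => c / 4 * (s - x) ^ 2) (c / 2 * (t - x)) t := by
    refine ((((hasDerivAt_id' t).sub_const x).fun_pow 2).const_mul (c / 4)).congr_deriv ?_
    simp
    ring
  have hderiv : deriv (fun t => g t - c / 4 * (t - x) ^ 2)
      =ᶠ[𝓝 x] fun t => deriv g t - c / 2 * (t - x) :=
    hd.mono fun t ht => (ht.hasDerivAt.fun_sub (hq t)).deriv
  have hg' : DifferentiableAt ℝ (deriv g) x := by
    exact ((hg.fderiv_right (m := 1) (by norm_num)).differentiableAt (by simp)).clm_apply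
      (differentiableAt_const (1 : ℝ))
  have hdd : deriv (deriv (fun t => g t - c / 4 * (t - x) ^ 2)) x = c / 2 := by
    rw [hderiv.deriv_eq]
    have := hg'.hasDerivAt.fun_sub ((((hasDerivAt_id' x).sub_const x)).const_mul (c / 2))
    rw [this.deriv]
    linarith
  have hmin : IsLocalMin (fun t => g t - c / 4 * (t - x) ^ 2) x := by
    apply isLocalMin_of_deriv_deriv_pos
    · rw [hdd]; linarith
    · simp [hderiv.self_of_nhds, hmax.deriv_eq_zero]
    · exact hg.continuousAt.sub (hq x).continuousAt
  have : ∀ᶠ t in 𝓝 x, t = x := by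
    filter_upwards [hmin, hmax] with t h1 h2
    have h3 : c / 4 * (t - x) ^ 2 ≤ 0 := by simp at h1 h2; linarith
    have h4 : (t - x) ^ 2 ≤ 0 := by
      by_contra! h
      nlinarith
    nlinarith [pow_eq_zero_iff (two_ne_zero) |>.1 (le_antisymm h4 (sq_nonneg _))]
  obtain ⟨ε, hε, h⟩ := Metric.eventually_nhds_iff.1 this
  have := h (y := x + ε / 2) (by simp [abs_of_pos hε, hε])
  linarith

theorem deriv_deriv_quadratic (a b c : ℝ) :
    deriv (deriv fun t : ℝ => a + b * t + c * t ^ 2) 0 = 2 * c := by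
  have h (t : ℝ) : HasDerivAt (fun t : ℝ => a + b * t + c * t ^ 2) (b + 2 * c * t) t := by
    refine ((((hasDerivAt_id' t).const_mul b).const_add a).fun_add
      (((hasDerivAt_id' t).fun_pow 2).const_mul c)).congr_deriv ?_
    simp
    ring
  rw [show deriv (fun t : ℝ => a + b * t + c * t ^ 2) = fun t => b + 2 * c * t from
    funext fun t => (h t).deriv]
  simp

/-- Weak maximum principle: a continuous function on a compact set which has no positive local
maximum relative to the set is nonpositive. -/
theorem nonpos_of_forall_not_isMaxOn {X : Type*} [TopologicalSpace X] {K : Set X} {w : X → ℝ}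
    (hK : IsCompact K) (hw : ContinuousOn w K)
    (h : ∀ x ∈ K, 0 < w x → ¬ IsMaxOn w K x) : ∀ x ∈ K, w x ≤ 0 := by
  intro x hx
  obtain ⟨z, hz, hmax⟩ := hK.exists_isMaxOn ⟨x, hx⟩ hw
  by_contra! hpos
  exact h z hz (hpos.trans_le (hmax hx)) hmax

section Laplacian

variable {E : Type*} [NormedAddCommGroup E] [InnerProductSpace ℝ E]

theorem deriv_deriv_line {f : E → ℝ} {x : E} (hf : ContDiffAt ℝ 2 f x) (v : E) :
    deriv (deriv fun t : ℝ => f (x + t • v)) 0 = iteratedFDeriv ℝ 2 f x ![v, v] := by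
  have hline (t : ℝ) : HasDerivAt (fun s : ℝ => x + s • v) v t := by
    simpa using ((hasDerivAt_id t).smul_const v).const_add x
  have hx : Tendsto (fun t : ℝ => x + t • v) (𝓝 0) (𝓝 x) := by
    simpa using (hline 0).continuousAt.tendsto
  have h1 : deriv (fun t : ℝ => f (x + t • v)) =ᶠ[𝓝 0] fun t => fderiv ℝ f (x + t • v) v := by
    filter_upwards [hx.eventually (hf.eventually (by simp))] with t ht
    exact ((ht.differentiableAt (by simp)).hasFDerivAt.comp_hasDerivAt t (hline t)).deriv
  rw [h1.deriv_eq, iteratedFDeriv_two_apply]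
  have h2 : DifferentiableAt ℝ (fderiv ℝ f) x :=
    (hf.fderiv_right (m := 1) (by norm_num)).differentiableAt (by simp)
  have h3 : HasDerivAt (fun t : ℝ => fderiv ℝ f (x + t • v)) (fderiv ℝ (fderiv ℝ f) x v) 0 :=
    h2.hasFDerivAt.comp_hasDerivAt_of_eq 0 (hline 0) (by simp)
  have h4 := h3.clm_apply (hasDerivAt_const (0 : ℝ) v)
  rw [h4.deriv]
  simp

theorem norm_add_smul_sub_sq (x c v : E) (t : ℝ) :
    ‖x + t • v - c‖ ^ 2 = ‖x - c‖ ^ 2 + 2 * t * ⟪x - c, v⟫ + t ^ 2 * ‖v‖ ^ 2 := by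
  rw [show x + t • v - c = (x - c) + t • v by abel, norm_add_sq_real, inner_smul_right,
    norm_smul, mul_pow, Real.norm_eq_abs, sq_abs]
  ring

/-- Reflection in the hyperplane through the origin orthogonal to `ν`. -/
theorem reflection_orthogonal_singleton_apply {ν : E} (hν : ‖ν‖ = 1) (z : E) :
    (ℝ ∙ ν)ᗮ.reflection z = z - (2 * ⟪ν, z⟫) • ν := by
  rw [Submodule.reflection_orthogonal_apply, Submodule.reflection_singleton_apply]
  simp [hν, mul_smul, two_smul]

theorem inner_add_of_inner_eq_zero {e H : E} (hH : ⟪e, H⟫ = 0) (X : E) : ⟪e, X + H⟫ = ⟪e, X⟫ := by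
  rw [inner_add_right, hH, add_zero]

variable [FiniteDimensional ℝ E]

theorem laplacian_eq_sum_deriv_deriv {ι : Type*} [Fintype ι] (b : OrthonormalBasis ι ℝ E)
    {f : E → ℝ} {x : E} (hf : ContDiffAt ℝ 2 f x) :
    Δ f x = ∑ i, deriv (deriv fun t : ℝ => f (x + t • b i)) 0 := by
  simp only [deriv_deriv_line hf, laplacian_eq_iteratedFDeriv_orthonormalBasis f b]

theorem laplacian_nonpos_of_isLocalMax {f : E → ℝ} {x : E} (hf : ContDiffAt ℝ 2 f x)
    (hmax : IsLocalMax f x) : Δ f x ≤ 0 := by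
  rw [laplacian_eq_sum_deriv_deriv (stdOrthonormalBasis ℝ E) hf]
  refine Finset.sum_nonpos fun i _ => ?_
  set v := stdOrthonormalBasis ℝ E i
  have hline : ContDiff ℝ 2 fun t : ℝ => x + t • v := by fun_prop
  have hx0 : x + (0 : ℝ) • v = x := by simp
  apply deriv_deriv_nonpos_of_isLocalMax
  · exact ContDiffAt.comp (0 : ℝ) (by simpa using hf) hline.contDiffAt
  · have hx : Tendsto (fun t : ℝ => x + t • v) (𝓝 0) (𝓝 x) := by
      simpa using hline.continuous.tendsto 0
    filter_upwards [hx.eventually hmax] with t ht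
    simpa using ht

theorem laplacian_comp_isometry {f : E → ℝ} {x : E} (c : E) (R : E ≃ₗᵢ[ℝ] E)
    (hf : ContDiffAt ℝ 2 f (R x + c)) :
    Δ (fun z => f (R z + c)) x = Δ f (R x + c) := by
  have hR : ContDiff ℝ 2 fun z => R z + c := R.contDiff.add contDiff_const
  have hcomp : ContDiffAt ℝ 2 (fun z => f (R z + c)) x :=
    ContDiffAt.comp x (g := f) (f := fun z => R z + c) hf hR.contDiffAt
  rw [laplacian_eq_sum_deriv_deriv (stdOrthonormalBasis ℝ E) hcomp,
    laplacian_eq_sum_deriv_deriv ((stdOrthonormalBasis ℝ E).map R) hf]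
  simp [add_right_comm]

theorem laplacian_norm_sub_sq (c x : E) :
    Δ (fun z : E => ‖z - c‖ ^ 2) x = 2 * Module.finrank ℝ E := by
  have hf : ContDiff ℝ 2 fun z : E => ‖z - c‖ ^ 2 := (contDiff_id.sub contDiff_const).norm_sq ℝ
  rw [laplacian_eq_sum_deriv_deriv (stdOrthonormalBasis ℝ E) hf.contDiffAt]
  have hline (i : Fin (Module.finrank ℝ E)) :
      deriv (deriv fun t : ℝ => ‖x + t • stdOrthonormalBasis ℝ E i - c‖ ^ 2) 0 = 2 := by
    simp_rw [norm_add_smul_sub_sq]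
    have := deriv_deriv_quadratic (‖x - c‖ ^ 2) (2 * ⟪x - c, stdOrthonormalBasis ℝ E i⟫) 1
    rw [mul_one] at this
    refine Eq.trans ?_ this
    congr 2
    ext t
    simp
    ring
  simp [hline, mul_comm]

theorem laplacian_inner_quadratic (c v x : E) (β : ℝ) (γ : ℝ) :
    Δ (fun z : E => β * ⟪v, z - c⟫ + γ * ⟪v, z - c⟫ ^ 2) x = 2 * γ * ‖v‖ ^ 2 := by
  have hf : ContDiff ℝ 2 fun z : E => β * ⟪v, z - c⟫ + γ * ⟪v, z - c⟫ ^ 2 := by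
    have : ContDiff ℝ 2 fun z : E => ⟪v, z - c⟫ :=
      contDiff_const.inner ℝ (contDiff_id.sub contDiff_const)
    fun_prop
  rw [laplacian_eq_sum_deriv_deriv (stdOrthonormalBasis ℝ E) hf.contDiffAt,
    ← OrthonormalBasis.sum_sq_inner_left (stdOrthonormalBasis ℝ E) v, Finset.mul_sum]
  refine Finset.sum_congr rfl fun i _ => ?_
  set b := stdOrthonormalBasis ℝ E i
  have := deriv_deriv_quadratic (β * ⟪v, x - c⟫ + γ * ⟪v, x - c⟫ ^ 2)
    (β * ⟪v, b⟫ + 2 * γ * ⟪v, x - c⟫ * ⟪v, b⟫) (γ * ⟪v, b⟫ ^ 2)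
  rw [mul_assoc, ← this]
  congr 2
  ext t
  rw [show x + t • b - c = (x - c) + t • b by abel, inner_add_right, inner_smul_right]
  ring

theorem laplacian_gaussian (α : ℝ) (c x : E) :
    Δ (fun z : E => Real.exp (-α * ‖z - c‖ ^ 2)) x =
      (4 * α ^ 2 * ‖x - c‖ ^ 2 - 2 * α * Module.finrank ℝ E) * Real.exp (-α * ‖x - c‖ ^ 2) := by
  have hf : ContDiff ℝ 2 fun z : E => Real.exp (-α * ‖z - c‖ ^ 2) :=
    (contDiff_const.mul ((contDiff_id.sub contDiff_const).norm_sq ℝ)).exp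
  rw [laplacian_eq_sum_deriv_deriv (stdOrthonormalBasis ℝ E) hf.contDiffAt]
  have key (A B : ℝ) : deriv (deriv fun t : ℝ => Real.exp (-α * (A + 2 * t * B + t ^ 2))) 0 =
      (4 * α ^ 2 * B ^ 2 - 2 * α) * Real.exp (-α * A) := by
    have hp (t : ℝ) : HasDerivAt (fun t : ℝ => -α * (A + 2 * t * B + t ^ 2))
        (-α * (2 * B + 2 * t)) t := by
      refine (((((hasDerivAt_id' t).const_mul 2).mul_const B).const_add A).fun_add
        ((hasDerivAt_id' t).fun_pow 2) |>.const_mul (-α)).congr_deriv ?_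
      simp
    rw [show (deriv fun t : ℝ => Real.exp (-α * (A + 2 * t * B + t ^ 2))) = fun t =>
      Real.exp (-α * (A + 2 * t * B + t ^ 2)) * (-α * (2 * B + 2 * t)) from
      funext fun t => (hp t).exp.deriv]
    have hq : HasDerivAt (fun t : ℝ => -α * (2 * B + 2 * t)) (-α * 2) 0 := by
      simpa using (((hasDerivAt_id (0 : ℝ)).const_mul 2).const_add (2 * B)).const_mul (-α)
    rw [((hp 0).exp.fun_mul hq).deriv]
    simp
    ring
  have hline (i : Fin (Module.finrank ℝ E)) : deriv (deriv fun t : ℝ =>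
      Real.exp (-α * ‖x + t • stdOrthonormalBasis ℝ E i - c‖ ^ 2)) 0 =
      (4 * α ^ 2 * ⟪x - c, stdOrthonormalBasis ℝ E i⟫ ^ 2 - 2 * α) *
        Real.exp (-α * ‖x - c‖ ^ 2) := by
    rw [← key]
    congr 2
    ext t
    simp [norm_add_smul_sub_sq]
  simp_rw [hline]
  rw [← Finset.sum_mul, Finset.sum_sub_distrib, ← Finset.mul_sum,
    OrthonormalBasis.sum_sq_inner_left]
  simp
  ring

/-- Gradient estimate: the oscillation of a harmonic function in the direction `ν` is controlled
by comparing it with its reflection. -/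
theorem harmonic_sub_le_of_ball {f : E → ℝ} {P ν : E} {ρ B t : ℝ} (hν : ‖ν‖ = 1) (hρ : 0 < ρ)
    (hB : 0 < B) (hcont : ∀ z, ‖z - P‖ ≤ ρ → ContDiffAt ℝ 2 f z)
    (hharm : ∀ z, ‖z - P‖ ≤ ρ → Δ f z = 0)
    (hosc : ∀ z z', ‖z - P‖ ≤ ρ → ‖z' - P‖ ≤ ρ → f z - f z' ≤ B)
    (ht0 : 0 ≤ t) (htρ : t ≤ ρ) :
    f (P + t • ν) - f (P - t • ν) ≤ B * (Module.finrank ℝ E + 1) * t / ρ := by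
  set n : ℝ := (Module.finrank ℝ E : ℝ) with hn
  have hn0 : 0 ≤ n := by positivity
  set R := (ℝ ∙ ν)ᗮ.reflection with hR
  set S : E → E := fun z => R z + (P - R P) with hS
  have hSP (z : E) : S z - P = R (z - P) := by simp [hS]; abel
  have hSnorm (z : E) : ‖S z - P‖ = ‖z - P‖ := by rw [hSP, R.norm_map]
  set ψ : E → ℝ := (B / ρ ^ 2) • (fun z => ‖z - P‖ ^ 2) +
    fun z => B * (n + 1) / ρ * ⟪ν, z - P⟫ + -(B * (n + 1) / ρ ^ 2) * ⟪ν, z - P⟫ ^ 2 with hψ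
  have hin : ContDiff ℝ 2 fun z : E => ⟪ν, z - P⟫ :=
    contDiff_const.inner ℝ (contDiff_id.sub contDiff_const)
  have hsq : ContDiff ℝ 2 fun z : E => ‖z - P‖ ^ 2 :=
    (contDiff_id.sub contDiff_const).norm_sq ℝ
  have hquad : ContDiff ℝ 2 fun z =>
      B * (n + 1) / ρ * ⟪ν, z - P⟫ + -(B * (n + 1) / ρ ^ 2) * ⟪ν, z - P⟫ ^ 2 := by fun_prop
  have hsq' : ContDiff ℝ 2 ((B / ρ ^ 2) • fun z : E => ‖z - P‖ ^ 2) := contDiff_const.smul hsq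
  have hψc : ContDiff ℝ 2 ψ := hsq'.add hquad
  have hψΔ (z : E) : Δ ψ z < 0 := by
    rw [hψ, hsq'.contDiffAt.laplacian_add hquad.contDiffAt, laplacian_smul _ hsq.contDiffAt,
      laplacian_norm_sub_sq, laplacian_inner_quadratic, hν, ← hn]
    have : 0 < B / ρ ^ 2 := by positivity
    simp only [smul_eq_mul]
    have e : B / ρ ^ 2 * (2 * n) + 2 * -(B * (n + 1) / ρ ^ 2) * 1 ^ 2 = -2 * (B / ρ ^ 2) := by
      ring
    rw [e]
    linarith
  have hScont : ContDiff ℝ 2 S := R.contDiff.add contDiff_const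
  have hfS (z : E) (hz : ‖z - P‖ ≤ ρ) : ContDiffAt ℝ 2 (fun z => f (S z)) z :=
    ContDiffAt.comp z (g := f) (f := S) (hcont _ (by rwa [hSnorm])) hScont.contDiffAt
  have hfSΔ (z : E) (hz : ‖z - P‖ ≤ ρ) : Δ (fun z => f (S z)) z = 0 := by
    rw [laplacian_comp_isometry (P - R P) R (hcont (S z) (by rwa [hSnorm]))]
    exact hharm (S z) (by rwa [hSnorm])
  set w : E → ℝ := (f - fun z => f (S z)) - ψ with hw
  have hwc (z : E) (hz : ‖z - P‖ ≤ ρ) : ContDiffAt ℝ 2 w z :=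
    ((hcont z hz).sub (hfS z hz)).sub hψc.contDiffAt
  have hwΔ (z : E) (hz : ‖z - P‖ ≤ ρ) : 0 < Δ w z := by
    have hfs : ContDiffAt ℝ 2 (f - fun z => f (S z)) z := (hcont z hz).sub (hfS z hz)
    rw [hw, hfs.laplacian_sub hψc.contDiffAt,
      (hcont z hz).laplacian_sub (hfS z hz), hharm z hz, hfSΔ z hz]
    linarith [hψΔ z]
  have hSx (z : E) : S z = z - (2 * ⟪ν, z - P⟫) • ν := by
    rw [← sub_left_inj (a := P), hSP, hR, reflection_orthogonal_singleton_apply hν]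
    abel
  have hK : IsCompact {z : E | ‖z - P‖ ≤ ρ ∧ 0 ≤ ⟪ν, z - P⟫} := by
    have : {z : E | ‖z - P‖ ≤ ρ ∧ 0 ≤ ⟪ν, z - P⟫} =
        Metric.closedBall P ρ ∩ {z | 0 ≤ ⟪ν, z - P⟫} := by
      ext z; simp [dist_eq_norm]
    rw [this]
    exact (isCompact_closedBall P ρ).inter_right (isClosed_le continuous_const hin.continuous)
  have hmain := nonpos_of_forall_not_isMaxOn hK
    (fun z hz => (hwc z hz.1).continuousAt.continuousWithinAt) (w := w) ?_
  · have hmem : P + t • ν ∈ {z : E | ‖z - P‖ ≤ ρ ∧ 0 ≤ ⟪ν, z - P⟫} := by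
      simp [norm_smul, hν, inner_smul_right, abs_of_nonneg ht0, ht0, htρ]
    have h := hmain _ hmem
    have hSt : S (P + t • ν) = P - t • ν := by
      rw [hSx]
      simp [inner_smul_right, hν]
      module
    simp only [hw, hψ, Pi.sub_apply, Pi.add_apply, Pi.smul_apply, hSt, smul_eq_mul,
      add_sub_cancel_left, inner_smul_right, norm_smul, real_inner_self_eq_norm_sq, hν] at h
    simp only [Real.norm_eq_abs, one_pow, mul_one, sq_abs] at h
    have h2 : 0 ≤ B * n * t ^ 2 / ρ ^ 2 := by positivity
    have e : B / ρ ^ 2 * t ^ 2 + (B * (n + 1) / ρ * t + -(B * (n + 1) / ρ ^ 2) * t ^ 2) =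
      B * (n + 1) * t / ρ - B * n * t ^ 2 / ρ ^ 2 := by ring
    linarith
  · rintro z ⟨hz, hz0⟩ hpos hmax
    have hwz : w z = f z - f (S z) - (B / ρ ^ 2 * ‖z - P‖ ^ 2 + (B * (n + 1) / ρ * ⟪ν, z - P⟫ +
      -(B * (n + 1) / ρ ^ 2) * ⟪ν, z - P⟫ ^ 2)) := rfl
    have hle : ⟪ν, z - P⟫ ≤ ρ := by
      have := real_inner_le_norm ν (z - P)
      rw [hν, one_mul] at this
      exact this.trans hz
    rcases hz.eq_or_lt with h1 | h1
    · have h2 := hosc z (S z) hz (by rwa [hSnorm])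
      have e : B / ρ ^ 2 * ρ ^ 2 + (B * (n + 1) / ρ * ⟪ν, z - P⟫ +
        -(B * (n + 1) / ρ ^ 2) * ⟪ν, z - P⟫ ^ 2) =
        B + B * (n + 1) * ⟪ν, z - P⟫ * (ρ - ⟪ν, z - P⟫) / ρ ^ 2 := by
        field_simp
        ring
      rw [h1, e] at hwz
      have : 0 ≤ B * (n + 1) * ⟪ν, z - P⟫ * (ρ - ⟪ν, z - P⟫) / ρ ^ 2 := by
        have := sub_nonneg.2 hle
        positivity
      linarith
    rcases hz0.eq_or_lt with h2 | h2
    · have hSz : S z = z := by rw [hSx, ← h2]; simp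
      rw [hSz, ← h2] at hwz
      have : 0 ≤ B / ρ ^ 2 * ‖z - P‖ ^ 2 := by positivity
      linarith
    · have hloc : IsLocalMax w z := by
        have h3 : ∀ᶠ y in 𝓝 z, ‖y - P‖ < ρ :=
          (continuous_id.sub continuous_const).norm.continuousAt.eventually_lt
            continuousAt_const h1
        have h4 : ∀ᶠ y in 𝓝 z, 0 < ⟪ν, y - P⟫ :=
          continuousAt_const.eventually_lt hin.continuous.continuousAt h2
        filter_upwards [h3, h4] with y h5 h6
        exact hmax ⟨h5.le, h6.le⟩
      exact (hwΔ z hz).not_ge (laplacian_nonpos_of_isLocalMax (hwc z hz) hloc)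

/-- Solutions of the thin obstacle problem with zero obstacle in the half-space
`{X | 0 < ⟪e, X⟫}`. -/
structure IsThinObstacleSolution (e : E) (U : E → ℝ) : Prop where
  contDiffOn : ContDiffOn ℝ 2 U {X | 0 < ⟪e, X⟫}
  laplacian_eq_zero : ∀ X, 0 < ⟪e, X⟫ → Δ U X = 0
  nonneg : ∀ X, ⟪e, X⟫ = 0 → 0 ≤ U X
  normal : ∀ X, ⟪e, X⟫ = 0 → ∃ l : ℝ,
    Tendsto (fun t : ℝ => (U (X + t • e) - U X) / t) (𝓝[>] 0) (𝓝 l) ∧ l ≤ 0 ∧ (0 < U X → l = 0)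

namespace IsThinObstacleSolution

variable {e H : E} {U : E → ℝ}

theorem contDiffAt (hU : IsThinObstacleSolution e U) {X : E} (hX : 0 < ⟪e, X⟫) :
    ContDiffAt ℝ 2 U X :=
  hU.contDiffOn.contDiffAt ((isOpen_lt continuous_const (by fun_prop)).mem_nhds hX)

theorem contDiffAt_translate (hU : IsThinObstacleSolution e U) (hH : ⟪e, H⟫ = 0) {X : E}
    (hX : 0 < ⟪e, X⟫) : ContDiffAt ℝ 2 (fun Z => U (Z + H)) X :=
  ContDiffAt.comp X (g := U) (f := fun Z => Z + H)
    (hU.contDiffAt (by rwa [inner_add_of_inner_eq_zero hH]))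
    (contDiff_id.add contDiff_const).contDiffAt

theorem contDiffAt_increment (hU : IsThinObstacleSolution e U) (hH : ⟪e, H⟫ = 0) {X : E}
    (hX : 0 < ⟪e, X⟫) : ContDiffAt ℝ 2 (fun Z => U (Z + H) - U Z) X :=
  (hU.contDiffAt_translate hH hX).sub (hU.contDiffAt hX)

theorem laplacian_increment (hU : IsThinObstacleSolution e U) (hH : ⟪e, H⟫ = 0) {X : E}
    (hX : 0 < ⟪e, X⟫) : Δ (fun Z => U (Z + H) - U Z) X = 0 := by
  have hX' : 0 < ⟪e, X + H⟫ := by rwa [inner_add_of_inner_eq_zero hH]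
  have h1 : Δ (fun Z => U (Z + H)) X = 0 :=
    (laplacian_comp_isometry (x := X) H (LinearIsometryEquiv.refl ℝ E) (hU.contDiffAt hX')).trans
      (hU.laplacian_eq_zero _ hX')
  have h2 := (hU.contDiffAt_translate hH hX).laplacian_sub (hU.contDiffAt hX)
  rw [h1, hU.laplacian_eq_zero X hX, sub_zero] at h2
  exact h2

/-- Where the increment is positive on the thin space, its one-sided normal derivative is
nonnegative. -/
theorem exists_normal_increment (hU : IsThinObstacleSolution e U) (hH : ⟪e, H⟫ = 0) {X : E}
    (hX : ⟪e, X⟫ = 0) (hpos : 0 < U (X + H) - U X) : ∃ l : ℝ, 0 ≤ l ∧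
    Tendsto (fun t : ℝ => ((U (X + t • e + H) - U (X + t • e)) - (U (X + H) - U X)) / t)
      (𝓝[>] 0) (𝓝 l) := by
  obtain ⟨l₁, h₁, -, hl₁⟩ := hU.normal (X + H) (by rw [inner_add_of_inner_eq_zero hH, hX])
  obtain ⟨l₂, h₂, hl₂, -⟩ := hU.normal X hX
  refine ⟨l₁ - l₂, ?_, (h₁.sub h₂).congr fun t => ?_⟩
  · rw [hl₁ (by linarith [hU.nonneg X hX])]
    linarith
  · rw [← sub_div, add_right_comm X H]
    congr 1
    ring

/-- Barrier estimate: if an increment stays below its upper bound `M` by `a` on a ball contained in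
the upper half-space, then it stays quantitatively below `M` on a larger half-ball. -/
theorem increment_le_of_ball (hU : IsThinObstacleSolution e U) (hUc : Continuous U)
    (hH : ⟪e, H⟫ = 0) {M a r b : ℝ} {Q : E}
    (hn : 0 < Module.finrank ℝ E) (hM : ∀ X, 0 ≤ ⟪e, X⟫ → U (X + H) - U X ≤ M)
    (ha : 0 < a) (haM : a ≤ M) (hr : 0 < r) (hQ : 0 < ⟪e, Q⟫)
    (hball : ∀ X, ‖X - Q‖ ≤ r → U (X + H) - U X ≤ M - a) {X : E}
    (hX0 : 0 ≤ ⟪e, X⟫) (hXr : r ≤ ‖X - Q‖) (hXb : ‖X - Q‖ ≤ b) :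
    U (X + H) - U X ≤ M - a * (Real.exp (-(Module.finrank ℝ E / r ^ 2) * ‖X - Q‖ ^ 2) -
      Real.exp (-(Module.finrank ℝ E / r ^ 2) * b ^ 2)) := by
  set n : ℝ := (Module.finrank ℝ E : ℝ) with hndef
  have hn0 : 0 < n := Nat.cast_pos.2 hn
  set α := n / r ^ 2 with hα
  have hα0 : 0 < α := by positivity
  set g : E → ℝ := fun Z => Real.exp (-α * ‖Z - Q‖ ^ 2) with hg
  have hgc : ContDiff ℝ 2 g :=
    (contDiff_const.mul ((contDiff_id.sub contDiff_const).norm_sq ℝ)).exp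
  set F : E → ℝ := fun Z => U (Z + H) - U Z with hF
  have hFc : Continuous F := by fun_prop
  set k := M + a * Real.exp (-α * b ^ 2) with hk
  set w : E → ℝ := (F + a • g) - fun _ => k with hw
  have hwz (Z : E) : w Z = F Z + a * g Z - k := rfl
  have hwcont : Continuous w := (hFc.add (hgc.continuous.const_smul a)).sub continuous_const
  set K : Set E := {Z | 0 ≤ ⟪e, Z⟫ ∧ r ≤ ‖Z - Q‖ ∧ ‖Z - Q‖ ≤ b} with hKdef
  have hnc : Continuous fun Z : E => ‖Z - Q‖ := by fun_prop
  have hec : Continuous fun Z : E => ⟪e, Z⟫ := by fun_prop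
  have hK : IsCompact K := by
    have : K = Metric.closedBall Q b ∩ ({Z | 0 ≤ ⟪e, Z⟫} ∩ {Z | r ≤ ‖Z - Q‖}) := by
      ext Z; simp [hKdef, dist_eq_norm]; tauto
    rw [this]
    exact (isCompact_closedBall Q b).inter_right
      ((isClosed_le continuous_const hec).inter (isClosed_le continuous_const hnc))
  suffices h : ∀ Z ∈ K, w Z ≤ 0 by
    have := h X ⟨hX0, hXr, hXb⟩
    rw [hwz] at this
    linarith
  refine nonpos_of_forall_not_isMaxOn hK hwcont.continuousOn ?_
  rintro Z ⟨hZ0, hZr, hZb⟩ hpos hmax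
  rw [hwz] at hpos
  have hg1 : g Z ≤ 1 := Real.exp_le_one_iff.2 (by
    have : 0 ≤ α * ‖Z - Q‖ ^ 2 := by positivity
    linarith)
  have hexp : 0 < Real.exp (-α * b ^ 2) := Real.exp_pos _
  have hag : a * g Z ≤ a := mul_le_of_le_one_right ha.le hg1
  rcases hZr.eq_or_lt with h1 | h1
  · have : 0 < a * Real.exp (-α * b ^ 2) := by positivity
    have : F Z ≤ M - a := hball Z h1.ge
    linarith
  rcases hZb.eq_or_lt with h2 | h2
  · have h3 : g Z = Real.exp (-α * b ^ 2) := by rw [hg]; simp only [h2]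
    have : F Z ≤ M := hM Z hZ0
    rw [h3] at hpos
    linarith
  have hnear : ∀ᶠ Y in 𝓝 Z, r < ‖Y - Q‖ ∧ ‖Y - Q‖ < b :=
    (continuousAt_const.eventually_lt hnc.continuousAt h1).and
      (hnc.continuousAt.eventually_lt continuousAt_const h2)
  rcases hZ0.eq_or_lt with h3 | h3
  · have hFpos : 0 < F Z := by
      have : 0 < a * Real.exp (-α * b ^ 2) := by positivity
      linarith
    obtain ⟨l, hl, hlim⟩ := hU.exists_normal_increment hH h3.symm hFpos
    have hline : Continuous fun t : ℝ => Z + t • e := by fun_prop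
    have hline0 : Tendsto (fun t : ℝ => Z + t • e) (𝓝[>] 0) (𝓝 Z) := by
      have : Tendsto (fun t : ℝ => Z + t • e) (𝓝 0) (𝓝 Z) := by simpa using hline.tendsto 0
      exact this.mono_left nhdsWithin_le_nhds
    have hgd : HasDerivAt (fun t : ℝ => a * g (Z + t • e))
        (a * (g Z * (2 * α * ⟪e, Q⟫))) 0 := by
      have hp : HasDerivAt (fun t : ℝ => -α * ‖Z + t • e - Q‖ ^ 2) (2 * α * ⟪e, Q⟫) 0 := by
        simp_rw [norm_add_smul_sub_sq]
        refine (((((hasDerivAt_id' (0 : ℝ)).const_mul 2).mul_const ⟪Z - Q, e⟫).const_add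
          (‖Z - Q‖ ^ 2)).fun_add (((hasDerivAt_id' (0 : ℝ)).fun_pow 2).mul_const (‖e‖ ^ 2))
          |>.const_mul (-α)).congr_deriv ?_
        rw [real_inner_comm, inner_sub_right, ← h3]
        simp
        ring
      simpa [hg] using (hp.exp.const_mul a)
    have hgslope : Tendsto (fun t : ℝ => (a * g (Z + t • e) - a * g Z) / t) (𝓝[>] 0)
        (𝓝 (a * (g Z * (2 * α * ⟪e, Q⟫)))) := by
      have := hgd.tendsto_slope_zero_right
      refine this.congr fun t => ?_
      simp [div_eq_inv_mul]
    have hsum := hlim.add hgslope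
    have hle : l + a * (g Z * (2 * α * ⟪e, Q⟫)) ≤ 0 := by
      refine le_of_tendsto hsum ?_
      filter_upwards [hline0.eventually hnear, self_mem_nhdsWithin] with t ht ht0
      have ht0 : 0 < t := ht0
      have hmem : Z + t • e ∈ K := by
        refine ⟨?_, ht.1.le, ht.2.le⟩
        rw [inner_add_right, ← h3, inner_smul_right]
        have := real_inner_self_nonneg (x := e)
        positivity
      have hwle : w (Z + t • e) ≤ w Z := hmax hmem
      rw [hwz, hwz] at hwle
      simp only [hF] at hwle
      rw [← add_div]
      exact div_nonpos_of_nonpos_of_nonneg (by linarith) ht0.le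
    have : 0 < a * (g Z * (2 * α * ⟪e, Q⟫)) := by
      have : 0 < g Z := Real.exp_pos _
      positivity
    linarith
  · have hloc : IsLocalMax w Z := by
      filter_upwards [hnear, continuousAt_const.eventually_lt hec.continuousAt h3] with Y hY hY0
      exact hmax ⟨hY0.le, hY.1.le, hY.2.le⟩
    have hFd : ContDiffAt ℝ 2 F Z := hU.contDiffAt_increment hH h3
    have hag : ContDiffAt ℝ 2 (a • g) Z := (hgc.const_smul a).contDiffAt
    have hFag : ContDiffAt ℝ 2 (F + a • g) Z := hFd.add hag
    have hwd : ContDiffAt ℝ 2 w Z := hFag.sub contDiffAt_const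
    have hΔ := laplacian_nonpos_of_isLocalMax hwd hloc
    rw [hw, hFag.laplacian_sub contDiffAt_const, hFd.laplacian_add hag,
      laplacian_smul _ hgc.contDiffAt, hU.laplacian_increment hH h3, laplacian_gaussian,
      laplacian_const, Pi.zero_apply, sub_zero, zero_add, smul_eq_mul] at hΔ
    have hr2 : r ^ 2 ≤ ‖Z - Q‖ ^ 2 := by gcongr
    have h5 : α * r ^ 2 = n := by rw [hα]; field_simp
    have h6 : 0 < 4 * α ^ 2 * ‖Z - Q‖ ^ 2 - 2 * α * n := by
      have : 4 * α ^ 2 * r ^ 2 ≤ 4 * α ^ 2 * ‖Z - Q‖ ^ 2 := by gcongr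
      have e1 : 4 * α ^ 2 * r ^ 2 = 4 * α * n := by rw [← h5]; ring
      have : 0 < α * n := by positivity
      linarith
    have h7 : 0 < a * ((4 * α ^ 2 * ‖Z - Q‖ ^ 2 - 2 * α * n) *
      Real.exp (-α * ‖Z - Q‖ ^ 2)) := by positivity
    linarith

/-- A Harnack type estimate: if an increment reaches a value close to its upper bound `M` at some
point, then it exceeds `M / 2` at every point of comparable scale. -/
theorem exists_increment_lower_bound (hU : IsThinObstacleSolution e U) (hUc : Continuous U)
    (he : ‖e‖ = 1) (hH : ⟪e, H⟫ = 0) {M B D : ℝ}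
    (hM : ∀ X, 0 ≤ ⟪e, X⟫ → U (X + H) - U X ≤ M) (hM0 : 0 < M)
    (hB : ∀ X Y, (U (X + H) - U X) - (U (Y + H) - U Y) ≤ B) (hMB : M ≤ B) (hD : 1 ≤ D) :
    ∃ δ > 0, ∀ R > 0, ∀ X, 0 ≤ ⟪e, X⟫ → M - δ < U (X + H) - U X →
      ∀ Z, ⟪e, Z⟫ = R → ‖X - Z‖ ≤ D * R → M / 2 ≤ U (Z + H) - U Z := by
  have : Nontrivial E := ⟨⟨e, 0, fun h => by simp [h] at he⟩⟩
  have hfin : 0 < Module.finrank ℝ E := Module.finrank_pos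
  set n : ℝ := (Module.finrank ℝ E : ℝ) with hndef
  have hn0 : 0 < n := Nat.cast_pos.2 hfin
  have hB0 : 0 < B := hM0.trans_le hMB
  set θ := M / (8 * B * (n + 1)) with hθ
  have hθ0 : 0 < θ := by positivity
  have hθ1 : θ ≤ 1 / 8 := by
    rw [hθ, div_le_div_iff₀ (by positivity) (by norm_num)]
    nlinarith
  set c := Real.exp (-(n * D ^ 2 / θ ^ 2)) - Real.exp (-(n * (2 * D) ^ 2 / θ ^ 2)) with hc
  have hc0 : 0 < c := by
    rw [hc, sub_pos, Real.exp_lt_exp, neg_lt_neg_iff]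
    gcongr
    linarith
  have hc1 : c ≤ 1 := by
    have h1 : Real.exp (-(n * D ^ 2 / θ ^ 2)) ≤ 1 :=
      Real.exp_le_one_iff.2 (neg_nonpos.2 (by positivity))
    have h2 := Real.exp_pos (-(n * (2 * D) ^ 2 / θ ^ 2))
    linarith
  refine ⟨M / 4 * c, by positivity, fun R hR X hX0 hX Z hZ hXZ => ?_⟩
  by_contra! hlt
  have hball : ∀ Y, ‖Y - Z‖ ≤ θ * R → U (Y + H) - U Y ≤ M - M / 4 := by
    intro Y hY
    rcases eq_or_ne Y Z with rfl | hne
    · linarith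
    have hYZ : 0 < ‖Y - Z‖ := norm_pos_iff.2 (sub_ne_zero.2 hne)
    set P := (1 / 2 : ℝ) • (Y + Z) with hP
    set ν := (‖Y - Z‖)⁻¹ • (Y - Z) with hν
    have hν1 : ‖ν‖ = 1 := by
      rw [hν, norm_smul, norm_inv, norm_norm, inv_mul_cancel₀ hYZ.ne']
    have htν : (‖Y - Z‖ / 2) • ν = (1 / 2 : ℝ) • (Y - Z) := by
      rw [hν, smul_smul]
      congr 1
      field_simp
    have hPY : P + (‖Y - Z‖ / 2) • ν = Y := by rw [htν, hP]; module
    have hPZ : P - (‖Y - Z‖ / 2) • ν = Z := by rw [htν, hP]; module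
    have hinner (W V : E) : ⟪e, W⟫ - ‖V - W‖ ≤ ⟪e, V⟫ := by
      have h1 := (abs_le.1 (abs_real_inner_le_norm e (V - W))).1
      rw [he, one_mul, inner_sub_right] at h1
      linarith
    have hPZn : ‖P - Z‖ = ‖Y - Z‖ / 2 := by
      rw [show P - Z = (1 / 2 : ℝ) • (Y - Z) by rw [hP]; module, norm_smul]
      norm_num
      ring
    have hθR : θ * R ≤ 1 / 8 * R := by gcongr
    have hpos (V : E) (hV : ‖V - P‖ ≤ R / 4) : 0 < ⟪e, V⟫ := by
      have h1 := hinner P V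
      have h2 := hinner Z P
      linarith
    have h := harmonic_sub_le_of_ball (f := fun X => U (X + H) - U X) (P := P) (ρ := R / 4)
      (t := ‖Y - Z‖ / 2) hν1 (by positivity) hB0
      (fun V hV => hU.contDiffAt_increment hH (hpos V hV))
      (fun V hV => hU.laplacian_increment hH (hpos V hV)) (fun V W _ _ => hB V W)
      (by positivity) (by linarith)
    rw [hPY, hPZ] at h
    have h2 : B * (n + 1) * (‖Y - Z‖ / 2) / (R / 4) ≤ M / 4 := by
      calc B * (n + 1) * (‖Y - Z‖ / 2) / (R / 4)
          ≤ B * (n + 1) * (θ * R / 2) / (R / 4) := by gcongr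
        _ = M / 4 := by rw [hθ]; field_simp; norm_num
    linarith
  have hr : 0 < θ * R := by positivity
  rcases le_total (θ * R) ‖X - Z‖ with h1 | h1
  · have h2 := hU.increment_le_of_ball hUc hH hfin hM (a := M / 4) (by positivity) (by linarith)
      hr (hZ ▸ hR) hball hX0 h1 (b := 2 * D * R) (by nlinarith)
    have h3 : Real.exp (-(n * D ^ 2 / θ ^ 2)) ≤ Real.exp (-(n / (θ * R) ^ 2) * ‖X - Z‖ ^ 2) := by
      rw [Real.exp_le_exp]
      have h4 : n / (θ * R) ^ 2 * ‖X - Z‖ ^ 2 ≤ n / (θ * R) ^ 2 * (D * R) ^ 2 := by gcongr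
      have h5 : n / (θ * R) ^ 2 * (D * R) ^ 2 = n * D ^ 2 / θ ^ 2 := by field_simp
      linarith
    have h4 : -(n / (θ * R) ^ 2) * (2 * D * R) ^ 2 = -(n * (2 * D) ^ 2 / θ ^ 2) := by
      field_simp
    rw [← hndef, h4] at h2
    have h5 : M / 4 * c ≤ M / 4 * (Real.exp (-(n / (θ * R) ^ 2) * ‖X - Z‖ ^ 2) -
        Real.exp (-(n * (2 * D) ^ 2 / θ ^ 2))) := by
      rw [hc]
      gcongr
    linarith
  · have h2 := hball X h1
    have h3 : M / 4 * c ≤ M / 4 := mul_le_of_le_one_right (by positivity) hc1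
    linarith

/-- A Lipschitz global solution has no positive tangential increment. -/
theorem increment_nonpos (hU : IsThinObstacleSolution e U) (he : ‖e‖ = 1) {L : ℝ}
    (hL : ∀ X Y, |U X - U Y| ≤ L * ‖X - Y‖) (h0 : U 0 = 0) (hH : ⟪e, H⟫ = 0) {X : E}
    (hX : 0 ≤ ⟪e, X⟫) : U (X + H) - U X ≤ 0 := by
  by_contra! hpos
  have hUc : Continuous U := by
    refine (LipschitzWith.of_dist_le_mul (K := L.toNNReal) fun X Y => ?_).continuous
    rw [Real.dist_eq, dist_eq_norm]
    exact (hL X Y).trans (by gcongr; exact Real.le_coe_toNNReal L)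
  have hinc (Y : E) : |U (Y + H) - U Y| ≤ L * ‖H‖ := by simpa using hL (Y + H) Y
  have hLH : 0 < L * ‖H‖ := hpos.trans_le ((le_abs_self _).trans (hinc X))
  have hL0 : 0 < L := pos_of_mul_pos_left hLH (norm_nonneg H)
  set s : Set ℝ := (fun Y => U (Y + H) - U Y) '' {Y | 0 ≤ ⟪e, Y⟫} with hs
  have hbdd : BddAbove s := ⟨L * ‖H‖, by
    rintro _ ⟨Y, -, rfl⟩
    exact (le_abs_self _).trans (hinc Y)⟩
  have hne : s.Nonempty := ⟨_, X, hX, rfl⟩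
  set M := sSup s with hMdef
  have hM (Y : E) (hY : 0 ≤ ⟪e, Y⟫) : U (Y + H) - U Y ≤ M := le_csSup hbdd ⟨Y, hY, rfl⟩
  have hM0 : 0 < M := hpos.trans_le (hM X hX)
  have hML : M ≤ L * ‖H‖ := csSup_le hne (by
    rintro _ ⟨Y, -, rfl⟩
    exact (le_abs_self _).trans (hinc Y))
  set σ := M / (5 * L) with hσ
  have hσ0 : 0 < σ := by positivity
  obtain ⟨δ, hδ, hδM⟩ := hU.exists_increment_lower_bound hUc he hH (B := 2 * (L * ‖H‖))
    (D := 2 + ‖H‖ / σ) hM hM0 (fun Y Z => by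
      have h1 := abs_le.1 (hinc Y)
      have h2 := abs_le.1 (hinc Z)
      linarith) (by linarith) (by
      have : 0 ≤ ‖H‖ / σ := by positivity
      linarith)
  obtain ⟨_, ⟨X₀, hX₀, rfl⟩, hX₀M⟩ := exists_lt_of_lt_csSup hne (show M - δ < sSup s by linarith)
  obtain ⟨N, hN⟩ := exists_nat_gt (‖X₀‖ / σ)
  have hN0 : (0 : ℝ) < N := lt_of_le_of_lt (by positivity) hN
  set R := N * σ with hR
  have hR0 : 0 < R := by positivity
  have hX₀R : ‖X₀‖ ≤ R := ((div_lt_iff₀ hσ0).1 hN).le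
  have hee : ⟪e, e⟫ = 1 := by rw [real_inner_self_eq_norm_sq, he, one_pow]
  have hstep (j : ℕ) (hj : j ≤ N) :
      M / 2 ≤ U (R • e - (j : ℝ) • H + H) - U (R • e - (j : ℝ) • H) := by
    refine hδM R hR0 X₀ hX₀ hX₀M _ ?_ ?_
    · rw [inner_sub_right, inner_smul_right, inner_smul_right, hee, hH]
      ring
    · calc ‖X₀ - (R • e - (j : ℝ) • H)‖ ≤ ‖X₀‖ + (‖R • e‖ + ‖(j : ℝ) • H‖) :=
            (norm_sub_le _ _).trans (by gcongr; exact norm_sub_le _ _)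
        _ ≤ R + (R + N * ‖H‖) := by
            rw [norm_smul, norm_smul, he, Real.norm_eq_abs, Real.norm_eq_abs, abs_of_pos hR0,
              abs_of_nonneg (Nat.cast_nonneg j), mul_one]
            gcongr
        _ = (2 + ‖H‖ / σ) * R := by rw [hR]; field_simp; ring
  have htel (j : ℕ) (hj : j ≤ N) : j * (M / 2) ≤ U (R • e) - U (R • e - (j : ℝ) • H) := by
    induction j with
    | zero => simp
    | succ j ih =>
      have h1 := ih (by omega)
      have h2 := hstep (j + 1) hj
      have h3 : R • e - ((j + 1 : ℕ) : ℝ) • H + H = R • e - (j : ℝ) • H := by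
        push_cast
        module
      rw [h3] at h2
      push_cast at h2 ⊢
      linarith
  have hfin := htel N le_rfl
  have hup : U (R • e) ≤ L * R := by
    have := (abs_le.1 (hL (R • e) 0)).2
    rwa [h0, sub_zero, sub_zero, norm_smul, he, mul_one, Real.norm_eq_abs, abs_of_pos hR0] at this
  have hlow : -(L * R) ≤ U (R • e - (N : ℝ) • H) := by
    have h1 := (abs_le.1 (hL (R • e - (N : ℝ) • H) (-((N : ℝ) • H)))).1
    rw [sub_neg_eq_add, sub_add_cancel, norm_smul, he, mul_one, Real.norm_eq_abs,
      abs_of_pos hR0] at h1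
    have h2 := hU.nonneg (-((N : ℝ) • H)) (by rw [inner_neg_right, inner_smul_right, hH]; simp)
    linarith
  have hLR : L * R = N * M / 5 := by rw [hR, hσ]; field_simp
  have : 0 < N * M := by positivity
  linarith

/-- Lipschitz global solutions of the thin obstacle problem which vanish at the origin vanish on
the thin space. -/
theorem eq_zero_of_lipschitz (hU : IsThinObstacleSolution e U) (he : ‖e‖ = 1) {L : ℝ}
    (hL : ∀ X Y, |U X - U Y| ≤ L * ‖X - Y‖) (h0 : U 0 = 0) {X : E} (hX : ⟪e, X⟫ = 0) :
    U X = 0 := by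
  have h := hU.increment_nonpos he hL h0 hX (X := 0) (by simp)
  rw [zero_add, h0, sub_zero] at h
  exact le_antisymm h (hU.nonneg X hX)

end IsThinObstacleSolution

end Laplacian

section Product

variable {d : ℕ}

theorem inner_toLp_zero_one (X : WithLp 2 (Esp d × ℝ)) :
    ⟪WithLp.toLp 2 ((0 : Esp d), (1 : ℝ)), X⟫ = (WithLp.ofLp X).2 := by
  simp [WithLp.prod_inner_apply]

theorem laplacian_comp_ofLp {u : Esp d × ℝ → ℝ} {X : WithLp 2 (Esp d × ℝ)}
    (hu : ContDiffAt ℝ 2 (fun Z : WithLp 2 (Esp d × ℝ) => u (WithLp.ofLp Z)) X) :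
    Δ (fun Z : WithLp 2 (Esp d × ℝ) => u (WithLp.ofLp Z)) X = lapH d u (WithLp.ofLp X) := by
  rw [laplacian_eq_sum_deriv_deriv
    ((EuclideanSpace.basisFun (Fin d) ℝ).prod (OrthonormalBasis.singleton (Fin 1) ℝ)) hu,
    Fintype.sum_sum_type]
  simp only [OrthonormalBasis.prod_apply, Sum.elim_inl, Sum.elim_inr, Function.comp_apply,
    EuclideanSpace.basisFun_apply, OrthonormalBasis.singleton_apply, LinearMap.inl_apply,
    LinearMap.inr_apply, Finset.univ_unique, Finset.sum_singleton, WithLp.ofLp_add,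
    WithLp.ofLp_smul, lapH]
  refine congrArg₂ _ (Finset.sum_congr rfl fun i _ => ?_) ?_
  · refine congrArg (fun g : ℝ → ℝ => deriv (deriv g) 0) (funext fun t => congrArg u ?_)
    ext <;> simp
  · refine congrArg (fun g : ℝ → ℝ => deriv (deriv g) 0) (funext fun t => congrArg u ?_)
    ext <;> simp

theorem HarmonicOnH.isThinObstacleSolution {u : Esp d × ℝ → ℝ}
    (hharm : HarmonicOnH d u {p : Esp d × ℝ | p.2 ≠ 0}) (hnn : ∀ x : Esp d, 0 ≤ u (x, 0))
    (hbdry : ∀ x : Esp d, ∃ L : ℝ, NormalDeriv d u x L ∧ L ≤ 0 ∧ (0 < u (x, 0) → L = 0)) :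
    IsThinObstacleSolution (WithLp.toLp 2 ((0 : Esp d), (1 : ℝ)))
      (fun X : WithLp 2 (Esp d × ℝ) => u (WithLp.ofLp X)) := by
  have hsm : ContDiffOn ℝ 2 (fun X : WithLp 2 (Esp d × ℝ) => u (WithLp.ofLp X))
      {X | 0 < ⟪WithLp.toLp 2 ((0 : Esp d), (1 : ℝ)), X⟫} := by
    refine hharm.1.comp (WithLp.prodContinuousLinearEquiv 2 ℝ (Esp d) ℝ).contDiff.contDiffOn
      fun X hX => ?_
    rw [mem_ofPred_eq, inner_toLp_zero_one] at hX
    exact hX.ne'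
  have hpt : ∀ X : WithLp 2 (Esp d × ℝ), ⟪WithLp.toLp 2 ((0 : Esp d), (1 : ℝ)), X⟫ = 0 →
      WithLp.ofLp X = ((WithLp.ofLp X).1, 0) := fun X hX =>
    Prod.ext rfl (by rw [← inner_toLp_zero_one, hX])
  refine ⟨hsm, fun X hX => ?_, fun X hX => ?_, fun X hX => ?_⟩
  · rw [laplacian_comp_ofLp (hsm.contDiffAt
      ((isOpen_lt continuous_const (by fun_prop)).mem_nhds hX))]
    rw [inner_toLp_zero_one] at hX
    exact hharm.2 _ hX.ne'
  · rw [hpt X hX]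
    exact hnn _
  · obtain ⟨L, hL, hL0, hL1⟩ := hbdry (WithLp.ofLp X).1
    refine ⟨L, hL.congr fun t => ?_, hL0, fun h => hL1 (by rwa [hpt X hX] at h)⟩
    have h : WithLp.ofLp (X + t • WithLp.toLp 2 ((0 : Esp d), (1 : ℝ))) =
        ((WithLp.ofLp X).1, t) := by
      rw [WithLp.ofLp_add, hpt X hX]
      ext <;> simp
    rw [h, hpt X hX]

theorem LipschitzWith.abs_sub_comp_ofLp_le {u : Esp d × ℝ → ℝ} {K : NNReal}
    (hu : LipschitzWith K u) (X Y : WithLp 2 (Esp d × ℝ)) :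
    |u (WithLp.ofLp X) - u (WithLp.ofLp Y)| ≤ K * ‖X - Y‖ := by
  rw [← Real.dist_eq]
  refine (hu.dist_le_mul _ _).trans (mul_le_mul_of_nonneg_left ?_ K.coe_nonneg)
  rw [dist_eq_norm, ← WithLp.ofLp_sub]
  exact max_le (WithLp.norm_fst_le (x := X - Y)) (WithLp.norm_snd_le (x := X - Y))

end Product

end ThinObstacle

/-- **Lipschitz global solutions of the thin obstacle problem.** If
`u : ℝ^{d+1} → ℝ` is Lipschitz, even in `y`, harmonic in `{y ≠ 0}`, with `u(·,0) ≥ 0`,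
and its one-sided vertical derivative on `{y = 0}` exists, is `≤ 0`, and vanishes where
`u(·,0) > 0`, and if `u(0,0) = 0`, then `u(·,0) ≡ 0`. -/
theorem statement16
    (d : ℕ) (hd : 1 ≤ d)
    (u : Esp d × ℝ → ℝ) (Lc : NNReal)
    (hLip : LipschitzWith Lc u)
    (heven : ∀ p : Esp d × ℝ, u (p.1, -p.2) = u p)
    (hharm : HarmonicOnH d u {p : Esp d × ℝ | p.2 ≠ 0})
    (hnn : ∀ x : Esp d, 0 ≤ u (x, 0))
    (hbdry : ∀ x : Esp d, ∃ L : ℝ, NormalDeriv d u x L ∧ L ≤ 0 ∧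
      (0 < u (x, 0) → L = 0))
    (h0 : u (0, 0) = 0) :
    ∀ x : Esp d, u (x, 0) = 0 := by
  intro x
  refine (hharm.isThinObstacleSolution hnn hbdry).eq_zero_of_lipschitz
    (X := WithLp.toLp 2 (x, (0 : ℝ))) ?_ hLip.abs_sub_comp_ofLp_le h0 ?_
  · simp
  · rw [inner_toLp_zero_one]
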